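/- arXiv:math/0307144 — 2 statements merged into one kernel-verified Lean document; each statement's English description precedes it below -/
import Mathlib

section
/- Let N ≥ 3, let K be a nonempty cone in ℝ^N, let α ≤ 2-N and M > 0, and let h : ℝ^N → ℝ be C² on K, harmonic on K (Δh(x) = 0 for x ∈ K), positive on K, positively homogeneous of degree α (h(t•x) = t^α·h(x) for all t > 0 and x ∈ K), and satisfy h(x) ≤ M whenever x ∈ K and ‖x‖ = 1. Let p > 1 - 2/α and set γ := -2/(p-1), so that α < γ < 0. Then α(α+N-2) - γ(γ+N-2) > 0, and for every c > 0 with (cM)^{p-1} ≤ α(α+N-2) - γ(γ+N-2), the function u(x) := c·h(x)·‖x‖^{γ-α} is C² and positive on K and satisfies -Δu(x) = c·(α(α+N-2) - γ(γ+N-2))·h(x)·‖x‖^{γ-α-2} ≥ u(x)^p > 0 for all x ∈ K. (The construction of positive supersolutions in cone-like domains above the critical exponent 1 - 2/α₋: a positive harmonic function on the cone homogeneous of degree α encodes the principal spherical eigenfunction with eigenvalue λ₁ = α(α+N-2).) -/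
open scoped Pointwise

/-- The Laplacian of `u : ℝ^N → ℝ`: the sum of its second partial derivatives. -/
noncomputable def lap {N : ℕ} (u : EuclideanSpace ℝ (Fin N) → ℝ)
    (x : EuclideanSpace ℝ (Fin N)) : ℝ :=
  ∑ i, fderiv ℝ (fun y => fderiv ℝ u y (EuclideanSpace.single i 1)) x (EuclideanSpace.single i 1)

/-- The derivative of `‖y‖ ^ β` at a nonzero point, for an arbitrary real exponent. -/
theorem hasFDerivAt_norm_rpow_of_ne_zero {E : Type*} [NormedAddCommGroup E]
    [InnerProductSpace ℝ E] {x : E} (hx : x ≠ 0) (β : ℝ) :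
    HasFDerivAt (fun y : E => ‖y‖ ^ β) ((β * ‖x‖ ^ (β - 2)) • innerSL ℝ x) x := by
  have key : ∀ (y : E) (s : ℝ), (‖y‖ ^ 2) ^ (s / 2) = ‖y‖ ^ s := fun y s => by
    rw [← Real.rpow_natCast, ← Real.rpow_mul (norm_nonneg y)]
    congr 1
    push_cast
    ring
  have hder := ((hasStrictFDerivAt_norm_sq x).hasFDerivAt).rpow_const (p := β / 2)
    (Or.inl (pow_ne_zero 2 (norm_ne_zero_iff.2 hx)))
  simp only [key] at hder
  convert hder using 1
  rw [show β / 2 - 1 = (β - 2) / 2 by ring, key]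
  ext v
  simp only [smul_apply, nsmul_eq_mul, smul_eq_mul]
  push_cast
  ring

/-- Euler's identity for positively homogeneous functions. -/
theorem fderiv_apply_self_of_homogeneous {E : Type*} [NormedAddCommGroup E]
    [NormedSpace ℝ E] {f : E → ℝ} {x : E} {α : ℝ} (hf : DifferentiableAt ℝ f x)
    (hhom : ∀ t : ℝ, 0 < t → f (t • x) = t ^ α * f x) :
    fderiv ℝ f x x = α * f x := by
  have hray : HasDerivAt (fun t : ℝ => t • x) x 1 := by
    simpa using (hasDerivAt_id (1 : ℝ)).smul_const x
  have hf' : HasFDerivAt f (fderiv ℝ f x) ((1 : ℝ) • x) := by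
    rw [one_smul]
    exact hf.hasFDerivAt
  have hcomp : HasDerivAt (fun t : ℝ => f (t • x)) (fderiv ℝ f x x) 1 :=
    hf'.comp_hasDerivAt 1 hray
  have hpow : HasDerivAt (fun t : ℝ => t ^ α * f x) (α * f x) 1 := by
    simpa using (Real.hasDerivAt_rpow_const (x := 1) (p := α)
      (Or.inl one_ne_zero)).mul_const (f x)
  refine hcomp.unique (hpow.congr_of_eventuallyEq ?_)
  filter_upwards [lt_mem_nhds one_pos] with t ht using hhom t ht

/-- The Laplacian of a function times a power of the norm. -/
theorem lap_mul_norm_rpow {N : ℕ} {f : EuclideanSpace ℝ (Fin N) → ℝ}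
    {x : EuclideanSpace ℝ (Fin N)} (hf : ContDiffAt ℝ 2 f x) (hx : x ≠ 0) (c β : ℝ) :
    lap (fun y => c * f y * ‖y‖ ^ β) x =
      c * (lap f x * ‖x‖ ^ β + 2 * β * ‖x‖ ^ (β - 2) * fderiv ℝ f x x
        + β * (β + N - 2) * ‖x‖ ^ (β - 2) * f x) := by
  have hfirst : ∀ i : Fin N,
      (fun y => fderiv ℝ (fun y => c * f y * ‖y‖ ^ β) y (EuclideanSpace.single i 1))
        =ᶠ[nhds x] fun y => c * (fderiv ℝ f y (EuclideanSpace.single i 1) * ‖y‖ ^ β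
          + f y * (β * ‖y‖ ^ (β - 2) * y i)) := by
    intro i
    filter_upwards [hf.eventually (by simp), isOpen_ne.mem_nhds hx] with y hfy hy
    have hd := ((hfy.differentiableAt (by norm_num)).hasFDerivAt.const_mul c).mul
      (hasFDerivAt_norm_rpow_of_ne_zero hy β)
    rw [HasFDerivAt.fderiv (f := fun y => c * f y * ‖y‖ ^ β) hd]
    simp only [add_apply, smul_apply, smul_eq_mul,
      innerSL_apply_apply, EuclideanSpace.inner_single_right]
    simp [-mul_eq_mul_left_iff]
    ring
  have hsecond : ∀ i : Fin N,
      fderiv ℝ (fun y => fderiv ℝ (fun y => c * f y * ‖y‖ ^ β) y (EuclideanSpace.single i 1)) x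
          (EuclideanSpace.single i 1) =
        c * (fderiv ℝ (fun y => fderiv ℝ f y (EuclideanSpace.single i 1)) x
            (EuclideanSpace.single i 1) * ‖x‖ ^ β
          + 2 * β * ‖x‖ ^ (β - 2) * (x i * fderiv ℝ f x (EuclideanSpace.single i 1))
          + β * (β - 2) * ‖x‖ ^ (β - 2 - 2) * f x * x i ^ 2
          + β * ‖x‖ ^ (β - 2) * f x) := by
    intro i
    rw [(hfirst i).fderiv_eq]
    have hdf : DifferentiableAt ℝ (fun y => fderiv ℝ f y (EuclideanSpace.single i 1)) x :=
      ((hf.fderiv_right (m := 1) (by norm_num)).differentiableAt (by norm_num)).clm_apply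
        (differentiableAt_const _)
    have hcoord : HasFDerivAt (fun y : EuclideanSpace ℝ (Fin N) => y i)
        (EuclideanSpace.proj i : EuclideanSpace ℝ (Fin N) →L[ℝ] ℝ) x :=
      (EuclideanSpace.proj i : EuclideanSpace ℝ (Fin N) →L[ℝ] ℝ).hasFDerivAt
    have hd := ((hdf.hasFDerivAt.mul (hasFDerivAt_norm_rpow_of_ne_zero hx β)).add
      ((hf.differentiableAt (by norm_num)).hasFDerivAt.mul
        (((hasFDerivAt_norm_rpow_of_ne_zero hx (β - 2)).const_mul β).mul hcoord))).const_mul c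
    rw [HasFDerivAt.fderiv (f := fun y => c * (fderiv ℝ f y (EuclideanSpace.single i 1) * ‖y‖ ^ β
          + f y * (β * ‖y‖ ^ (β - 2) * y i))) hd]
    simp only [add_apply, smul_apply, smul_eq_mul,
      innerSL_apply_apply, EuclideanSpace.inner_single_right]
    simp [-mul_eq_mul_left_iff]
    ring
  have heuler : ∑ i, x i * fderiv ℝ f x (EuclideanSpace.single i 1) = fderiv ℝ f x x := by
    have hsum : x = ∑ i, x i • EuclideanSpace.single i (1 : ℝ) := by
      simpa using ((EuclideanSpace.basisFun (Fin N) ℝ).sum_repr x).symm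
    calc _ = fderiv ℝ f x (∑ i, x i • EuclideanSpace.single i (1 : ℝ)) := by
          simp only [map_sum, map_smul, smul_eq_mul]
      _ = fderiv ℝ f x x := by rw [← hsum]
  have hnorm : ∑ i, x i ^ 2 = ‖x‖ ^ 2 := (EuclideanSpace.real_norm_sq_eq x).symm
  have hpow : ‖x‖ ^ (β - 2 - 2) * ‖x‖ ^ 2 = ‖x‖ ^ (β - 2) := by
    rw [← Real.rpow_natCast, ← Real.rpow_add (norm_pos_iff.2 hx)]
    congr 1
    push_cast
    ring
  rw [lap, Finset.sum_congr rfl fun i _ => hsecond i, ← Finset.mul_sum]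
  simp only [Finset.sum_add_distrib, ← Finset.mul_sum, ← Finset.sum_mul, heuler, hnorm,
    Finset.sum_const, Finset.card_univ, Fintype.card_fin, nsmul_eq_mul]
  rw [lap]
  linear_combination (c * β * (β - 2) * f x) * hpow

/-- A homogeneous function bounded on the unit sphere is bounded by a power of the norm. -/
theorem le_mul_norm_rpow_of_homogeneous {E : Type*} [NormedAddCommGroup E]
    [NormedSpace ℝ E] {K : Set E} (hKcone : ∀ t : ℝ, 0 < t → t • K = K) {f : E → ℝ} {α M : ℝ}
    (hhom : ∀ t : ℝ, 0 < t → ∀ x ∈ K, f (t • x) = t ^ α * f x)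
    (hbound : ∀ x ∈ K, ‖x‖ = 1 → f x ≤ M) {x : E} (hxK : x ∈ K) (hx : x ≠ 0) :
    f x ≤ M * ‖x‖ ^ α := by
  have hr : 0 < ‖x‖ := norm_pos_iff.2 hx
  have hmem : ‖x‖⁻¹ • x ∈ K := by
    rw [← hKcone _ (inv_pos.2 hr)]
    exact Set.smul_mem_smul_set hxK
  have hle := hbound _ hmem (by
    rw [norm_smul, norm_inv, norm_norm, inv_mul_cancel₀ hr.ne'])
  have heq := hhom _ hr _ hmem
  rw [smul_smul, mul_inv_cancel₀ hr.ne', one_smul] at heq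
  rw [heq, mul_comm]
  exact mul_le_mul_of_nonneg_right hle (Real.rpow_nonneg hr.le _)

/-- Positive supersolutions of `-Δu = u^p` on a cone `K` above the critical exponent
`1 - 2/α`, built from a positive harmonic function on `K` homogeneous of degree `α`. -/
theorem cone_supersolution_above_critical
    (N : ℕ) (hN : 3 ≤ N)
    (K : Set (EuclideanSpace ℝ (Fin N))) (hKopen : IsOpen K)
    (hK0 : K ⊆ {x | x ≠ 0}) (hKcone : ∀ t : ℝ, 0 < t → t • K = K) (hKne : K.Nonempty)
    (α M : ℝ) (hα : α ≤ 2 - (N : ℝ)) (hM : 0 < M)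
    (h : EuclideanSpace ℝ (Fin N) → ℝ)
    (hC2 : ContDiffOn ℝ 2 h K)
    (hharm : ∀ x ∈ K, lap h x = 0)
    (hpos : ∀ x ∈ K, 0 < h x)
    (hhom : ∀ t : ℝ, 0 < t → ∀ x ∈ K, h (t • x) = t ^ α * h x)
    (hbound : ∀ x ∈ K, ‖x‖ = 1 → h x ≤ M)
    (p : ℝ) (hp : 1 - 2 / α < p) (γ : ℝ) (hγ : γ = -2 / (p - 1)) :
    (α < γ ∧ γ < 0) ∧
    0 < α * (α + (N : ℝ) - 2) - γ * (γ + (N : ℝ) - 2) ∧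
    ∀ c : ℝ, 0 < c →
      (c * M) ^ (p - 1) ≤ α * (α + (N : ℝ) - 2) - γ * (γ + (N : ℝ) - 2) →
      ContDiffOn ℝ 2 (fun x => c * h x * ‖x‖ ^ (γ - α)) K ∧
      (∀ x ∈ K, 0 < c * h x * ‖x‖ ^ (γ - α)) ∧
      (∀ x ∈ K,
        -lap (fun y => c * h y * ‖y‖ ^ (γ - α)) x
            = c * (α * (α + (N : ℝ) - 2) - γ * (γ + (N : ℝ) - 2)) * h x * ‖x‖ ^ (γ - α - 2) ∧
        (c * h x * ‖x‖ ^ (γ - α)) ^ p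
            ≤ c * (α * (α + (N : ℝ) - 2) - γ * (γ + (N : ℝ) - 2)) * h x * ‖x‖ ^ (γ - α - 2) ∧
        0 < (c * h x * ‖x‖ ^ (γ - α)) ^ p) := by
  have hN' : (3 : ℝ) ≤ N := by exact_mod_cast hN
  have hα0 : α < 0 := by linarith
  have hp1 : 0 < p - 1 := by
    have : 0 < -(2 / α) := neg_pos.2 (div_neg_of_pos_of_neg two_pos hα0)
    linarith
  have hγp : γ * (p - 1) = -2 := by
    rw [hγ]
    field_simp
  have hαp : α * (p - 1) < -2 := by
    have hlt : -(2 / α) < p - 1 := by linarith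
    have hmul := mul_lt_mul_of_neg_left hlt hα0
    rwa [mul_neg, mul_div_cancel₀ _ hα0.ne] at hmul
  have hαγ : α < γ := lt_of_mul_lt_mul_right (hαp.trans_eq hγp.symm) hp1.le
  have hγ0 : γ < 0 := by
    rw [hγ]
    exact div_neg_of_neg_of_pos (by norm_num) hp1
  have hA : 0 < α * (α + (N : ℝ) - 2) - γ * (γ + (N : ℝ) - 2) := by
    have : 0 < (γ - α) * -(α + γ + N - 2) := mul_pos (by linarith) (by linarith)
    linarith
  refine ⟨⟨hαγ, hγ0⟩, hA, fun c hc hcM => ?_⟩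
  have hu : ∀ x ∈ K, 0 < c * h x * ‖x‖ ^ (γ - α) := fun x hx =>
    mul_pos (mul_pos hc (hpos x hx)) (Real.rpow_pos_of_pos (norm_pos_iff.2 (hK0 hx)) _)
  refine ⟨?_, hu, fun x hxK => ⟨?_, ?_, Real.rpow_pos_of_pos (hu x hxK) p⟩⟩
  · exact (contDiffOn_const.mul hC2).mul fun x hx =>
      (((contDiffAt_norm ℝ (hK0 hx)).rpow_const_of_ne
        (norm_ne_zero_iff.2 (hK0 hx))).contDiffWithinAt)
  · have hfx := hC2.contDiffAt (hKopen.mem_nhds hxK)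
    rw [lap_mul_norm_rpow hfx (hK0 hxK), hharm x hxK, fderiv_apply_self_of_homogeneous
      (hfx.differentiableAt (by norm_num)) fun t ht => hhom t ht x hxK]
    ring
  · have hr : 0 < ‖x‖ := norm_pos_iff.2 (hK0 hxK)
    set u := c * h x * ‖x‖ ^ (γ - α) with hu_def
    have hux : 0 < u := hu x hxK
    have hule : u ≤ c * M * ‖x‖ ^ γ := by
      have hle := le_mul_norm_rpow_of_homogeneous hKcone hhom hbound hxK (hK0 hxK)
      calc u ≤ c * (M * ‖x‖ ^ α) * ‖x‖ ^ (γ - α) := by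
            rw [hu_def]
            gcongr
        _ = c * M * (‖x‖ ^ α * ‖x‖ ^ (γ - α)) := by ring
        _ = c * M * ‖x‖ ^ γ := by rw [← Real.rpow_add hr, add_sub_cancel]
    calc u ^ p = u ^ (p - 1) * u := by
          rw [Real.rpow_sub_one hux.ne', div_mul_cancel₀ _ hux.ne']
      _ ≤ (c * M * ‖x‖ ^ γ) ^ (p - 1) * u := by gcongr
      _ = (c * M) ^ (p - 1) * ‖x‖ ^ (-2 : ℝ) * u := by
          rw [Real.mul_rpow (by positivity) (by positivity), ← Real.rpow_mul hr.le, hγp]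
      _ ≤ (α * (α + (N : ℝ) - 2) - γ * (γ + (N : ℝ) - 2)) * ‖x‖ ^ (-2 : ℝ) * u := by gcongr
      _ = c * (α * (α + (N : ℝ) - 2) - γ * (γ + (N : ℝ) - 2)) * h x * ‖x‖ ^ (γ - α - 2) := by
          rw [hu_def, sub_eq_add_neg (γ - α) 2, Real.rpow_add hr]
          ring
end

section
/- Let N ≥ 3, ρ > 0, and let V : ℝ^N → ℝ satisfy V(x) ≥ 0 for all ‖x‖ > ρ and ‖x‖²·V(x) → ∞ as ‖x‖ → ∞. Then there is no function u : ℝ^N → ℝ which is C² on {x : ‖x‖ > ρ}, positive there, and satisfies -Δu(x) ≥ V(x)·u(x) for all x with ‖x‖ > ρ. (The paper's Nonexistence Lemma 2.7 in the case a = id, Ω = S^{N-1}.) -/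
open Filter Topology

/-- Second-order necessary condition for a local minimum on the line. -/
theorem IsLocalMin.deriv_deriv_nonneg {f : ℝ → ℝ} {a : ℝ} (h : IsLocalMin f a)
    (hc : ContinuousAt f a) : 0 ≤ deriv (deriv f) a := by
  by_contra! hneg
  have hmax : IsLocalMax f a := isLocalMax_of_deriv_deriv_neg hneg h.deriv_eq_zero hc
  have hconst : f =ᶠ[𝓝 a] fun _ => f a := by
    filter_upwards [h, hmax] with x h₁ h₂ using le_antisymm h₂ h₁
  have hzero : deriv (deriv f) a = 0 := by
    rw [hconst.deriv.deriv_eq]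
    simp
  exact hneg.ne hzero

section

variable {N : ℕ}

theorem ContDiffAt.differentiableAt_fderiv_apply {E : Type*} [NormedAddCommGroup E]
    [NormedSpace ℝ E] {u : E → ℝ} {x : E} (hu : ContDiffAt ℝ 2 u x) (e : E) :
    DifferentiableAt ℝ (fun y => fderiv ℝ u y e) x := by
  have h : ContDiffAt ℝ 1 (fderiv ℝ u) x := hu.fderiv_right (by norm_num)
  exact (h.differentiableAt (by norm_num)).clm_apply (differentiableAt_const e)

theorem ContDiffAt.deriv_deriv_comp_line {E : Type*} [NormedAddCommGroup E]
    [NormedSpace ℝ E] {u : E → ℝ} {x : E} (hu : ContDiffAt ℝ 2 u x) (e : E) :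
    deriv (deriv fun t : ℝ => u (x + t • e)) 0 = fderiv ℝ (fun y => fderiv ℝ u y e) x e := by
  have hline : ∀ t : ℝ, HasDerivAt (fun t : ℝ => x + t • e) e t := fun t => by
    simpa using ((hasDerivAt_id t).smul_const e).const_add x
  have htend : Tendsto (fun t : ℝ => x + t • e) (𝓝 0) (𝓝 x) := by
    simpa [ContinuousAt] using (hline 0).continuousAt
  have hfirst : (deriv fun t : ℝ => u (x + t • e)) =ᶠ[𝓝 0]
      fun t => fderiv ℝ u (x + t • e) e := by
    filter_upwards [htend.eventually (hu.eventually (by simp))] with t ht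
    exact ((ht.differentiableAt (by norm_num)).hasFDerivAt.comp_hasDerivAt t (hline t)).deriv
  rw [hfirst.deriv_eq]
  have hx : x + (0 : ℝ) • e = x := by simp
  have hsecond := (hx.symm ▸ hu.differentiableAt_fderiv_apply e :
    DifferentiableAt ℝ (fun y => fderiv ℝ u y e) (x + (0 : ℝ) • e)).hasFDerivAt.comp_hasDerivAt
      0 (hline 0)
  rw [hx] at hsecond
  exact hsecond.deriv

theorem lap_nonneg_of_isLocalMin {u : EuclideanSpace ℝ (Fin N) → ℝ}
    {x : EuclideanSpace ℝ (Fin N)} (hu : ContDiffAt ℝ 2 u x) (hmin : IsLocalMin u x) :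
    0 ≤ lap u x := by
  refine Finset.sum_nonneg fun i _ => ?_
  rw [← hu.deriv_deriv_comp_line]
  set e : EuclideanSpace ℝ (Fin N) := EuclideanSpace.single i 1
  have hx : x + (0 : ℝ) • e = x := by simp
  have hline : ContinuousAt (fun t : ℝ => x + t • e) 0 := by fun_prop
  have htend : Tendsto (fun t : ℝ => x + t • e) (𝓝 0) (𝓝 x) := by
    simpa [ContinuousAt] using hline
  refine IsLocalMin.deriv_deriv_nonneg ?_ ?_
  · filter_upwards [htend.eventually hmin] with t ht
    simpa using ht
  · exact ContinuousAt.comp (g := u) (hx.symm ▸ hu.continuousAt) hline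

theorem lap_const_mul_sub {u w : EuclideanSpace ℝ (Fin N) → ℝ} {x : EuclideanSpace ℝ (Fin N)}
    (hu : ContDiffAt ℝ 2 u x) (hw : ContDiffAt ℝ 2 w x) (m : ℝ) :
    lap (fun y => m * u y - w y) x = m * lap u x - lap w x := by
  unfold lap
  rw [Finset.mul_sum, ← Finset.sum_sub_distrib]
  refine Finset.sum_congr rfl fun i _ => ?_
  set e : EuclideanSpace ℝ (Fin N) := EuclideanSpace.single i 1
  have hfirst : (fun y => fderiv ℝ (fun y => m * u y - w y) y e) =ᶠ[𝓝 x]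
      fun y => m * fderiv ℝ u y e - fderiv ℝ w y e := by
    filter_upwards [hu.eventually (by simp), hw.eventually (by simp)] with y hy hy'
    have h := ((hy.differentiableAt (by norm_num)).hasFDerivAt.const_mul m).sub
      (hy'.differentiableAt (by norm_num)).hasFDerivAt
    rw [HasFDerivAt.fderiv (f := fun y => m * u y - w y) h]
    simp
  rw [hfirst.fderiv_eq]
  have h := ((hu.differentiableAt_fderiv_apply e).hasFDerivAt.const_mul m).sub
    (hw.differentiableAt_fderiv_apply e).hasFDerivAt
  rw [HasFDerivAt.fderiv (f := fun y => m * fderiv ℝ u y e - fderiv ℝ w y e) h]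
  simp

/-- The Laplacian of a radial function, written in terms of the squared norm. -/
theorem lap_comp_norm_sq {p p' p'' : ℝ → ℝ} (hp : ∀ s, HasDerivAt p (p' s) s)
    (hp' : ∀ s, HasDerivAt p' (p'' s) s) (hsmooth : ContDiff ℝ 2 p)
    (x : EuclideanSpace ℝ (Fin N)) :
    lap (fun y => p (‖y‖ ^ 2)) x = 4 * ‖x‖ ^ 2 * p'' (‖x‖ ^ 2) + 2 * N * p' (‖x‖ ^ 2) := by
  have hw : ContDiff ℝ 2 fun y : EuclideanSpace ℝ (Fin N) => p (‖y‖ ^ 2) :=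
    hsmooth.comp (contDiff_norm_sq ℝ)
  have hterm : ∀ i : Fin N, fderiv ℝ (fun y => fderiv ℝ
      (fun y : EuclideanSpace ℝ (Fin N) => p (‖y‖ ^ 2)) y (EuclideanSpace.single i 1)) x
      (EuclideanSpace.single i 1) = 4 * p'' (‖x‖ ^ 2) * x i ^ 2 + 2 * p' (‖x‖ ^ 2) := by
    intro i
    rw [← hw.contDiffAt.deriv_deriv_comp_line]
    have hnorm : ∀ t : ℝ, ‖x + t • EuclideanSpace.single i (1 : ℝ)‖ ^ 2
        = ‖x‖ ^ 2 + 2 * x i * t + t ^ 2 := by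
      intro t
      rw [norm_add_sq_real, inner_smul_right, norm_smul]
      simp [EuclideanSpace.inner_single_right]
      ring
    have hpoly : ∀ t : ℝ, HasDerivAt (fun t : ℝ => ‖x‖ ^ 2 + 2 * x i * t + t ^ 2)
        (2 * x i + 2 * t) t := by
      intro t
      have h := (((hasDerivAt_id t).const_mul (2 * x i)).const_add (‖x‖ ^ 2)).add
        ((hasDerivAt_id t).pow 2)
      refine h.congr_deriv ?_
      simp
    have hfirst : (deriv fun t : ℝ => p (‖x + t • EuclideanSpace.single i (1 : ℝ)‖ ^ 2))
        = fun t => p' (‖x‖ ^ 2 + 2 * x i * t + t ^ 2) * (2 * x i + 2 * t) := by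
      funext t
      simp only [hnorm]
      exact ((hp _).comp t (hpoly t)).deriv
    rw [hfirst]
    have hlin : HasDerivAt (fun t : ℝ => 2 * x i + 2 * t) 2 0 := by
      simpa using ((hasDerivAt_id (0 : ℝ)).const_mul 2).const_add (2 * x i)
    have hsecond := ((hp' _).comp (0 : ℝ) (hpoly 0)).mul hlin
    refine hsecond.deriv.trans ?_
    simp
    ring
  unfold lap
  simp only [hterm]
  rw [Finset.sum_add_distrib, ← Finset.mul_sum, EuclideanSpace.real_norm_sq_eq]
  simp
  ring

/-- The radial bump `((‖x‖² - a)(4a - ‖x‖²))²`, which vanishes on the boundary of the annulus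
`a ≤ ‖x‖² ≤ 4a`. -/
noncomputable def annulusBump (a : ℝ) (x : EuclideanSpace ℝ (Fin N)) : ℝ :=
  ((‖x‖ ^ 2 - a) * (4 * a - ‖x‖ ^ 2)) ^ 2

theorem contDiff_annulusBump (a : ℝ) :
    ContDiff ℝ 2 (annulusBump a : EuclideanSpace ℝ (Fin N) → ℝ) := by
  have h : ContDiff ℝ 2 fun y : EuclideanSpace ℝ (Fin N) => ‖y‖ ^ 2 := contDiff_norm_sq ℝ
  exact ((h.sub contDiff_const).mul (contDiff_const.sub h)).pow 2

theorem lap_annulusBump (a : ℝ) (x : EuclideanSpace ℝ (Fin N)) :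
    lap (annulusBump a) x =
      4 * ‖x‖ ^ 2 * (18 * a ^ 2 - 12 * ((‖x‖ ^ 2 - a) * (4 * a - ‖x‖ ^ 2))) +
        4 * N * ((‖x‖ ^ 2 - a) * (4 * a - ‖x‖ ^ 2)) * (5 * a - 2 * ‖x‖ ^ 2) := by
  have hg : ∀ s : ℝ, HasDerivAt (fun s => (s - a) * (4 * a - s)) (5 * a - 2 * s) s := by
    intro s
    refine (((hasDerivAt_id s).sub_const a).mul ((hasDerivAt_id s).const_sub (4 * a))).congr_deriv ?_
    simp
    ring
  have hp : ∀ s : ℝ, HasDerivAt (fun s => ((s - a) * (4 * a - s)) ^ 2)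
      (2 * ((s - a) * (4 * a - s)) * (5 * a - 2 * s)) s := by
    intro s
    refine ((hg s).pow 2).congr_deriv ?_
    simp
  have hp' : ∀ s : ℝ, HasDerivAt (fun s => 2 * ((s - a) * (4 * a - s)) * (5 * a - 2 * s))
      (18 * a ^ 2 - 12 * ((s - a) * (4 * a - s))) s := by
    intro s
    refine (((hg s).const_mul 2).mul (((hasDerivAt_id s).const_mul 2).const_sub
      (5 * a))).congr_deriv ?_
    simp
    ring
  refine (lap_comp_norm_sq hp hp' (by fun_prop) x).trans ?_
  ring

/-- The bump is a subsolution of `-Δw = M ‖x‖⁻² w` with a constant `M` independent of the scale. -/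
theorem neg_norm_sq_mul_lap_annulusBump_le {a : ℝ} (ha : 0 < a) {x : EuclideanSpace ℝ (Fin N)}
    (h₁ : a ≤ ‖x‖ ^ 2) (h₂ : ‖x‖ ^ 2 ≤ 4 * a) :
    -(‖x‖ ^ 2 * lap (annulusBump a) x) ≤ (768 + 48 * (N : ℝ)) ^ 2 * annulusBump a x := by
  rw [lap_annulusBump, annulusBump]
  obtain ⟨t, ht⟩ : ∃ t, ‖x‖ ^ 2 = a * t := ⟨‖x‖ ^ 2 / a, by field_simp⟩
  rw [ht] at h₁ h₂ ⊢
  have ht₁ : 1 ≤ t := by nlinarith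
  have ht₂ : t ≤ 4 := by nlinarith
  obtain ⟨g, hg⟩ : ∃ g, g = (t - 1) * (4 - t) := ⟨_, rfl⟩
  have hg₀ : 0 ≤ g := hg ▸ mul_nonneg (by linarith) (by linarith)
  have hN : (0 : ℝ) ≤ N := N.cast_nonneg
  have hA : t ^ 2 * (48 * g) ≤ 16 * (48 * g) :=
    mul_le_mul_of_nonneg_right (by nlinarith) (by positivity)
  have hB : t * (2 * t - 5) * (4 * N * g) ≤ 12 * (4 * N * g) :=
    mul_le_mul_of_nonneg_right (by nlinarith) (by positivity)
  have hC : (768 + 48 * (N : ℝ)) * g - 72 ≤ ((768 + 48 * (N : ℝ)) * g) ^ 2 := by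
    nlinarith [sq_nonneg ((768 + 48 * (N : ℝ)) * g - 1)]
  have hkey : -(t * (4 * t * (18 - 12 * g) + 4 * N * g * (5 - 2 * t)))
      ≤ (768 + 48 * (N : ℝ)) ^ 2 * g ^ 2 := by
    nlinarith
  have hscaled := mul_le_mul_of_nonneg_left hkey (pow_nonneg ha.le 4)
  have hag : (a * t - a) * (4 * a - a * t) = a ^ 2 * g := by
    rw [hg]
    ring
  rw [hag]
  linarith

end

/-- Nonexistence Lemma (exterior domain case): if `V ≥ 0` on `{‖x‖ > ρ}` and
`‖x‖²V(x) → ∞` as `‖x‖ → ∞`, then `-Δu - Vu = 0` has no positive supersolution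
on `{‖x‖ > ρ}`. -/
theorem nonexistence_lemma_exterior
    (N : ℕ) (hN : 3 ≤ N) (ρ : ℝ) (hρ : 0 < ρ)
    (V : EuclideanSpace ℝ (Fin N) → ℝ)
    (hV0 : ∀ x : EuclideanSpace ℝ (Fin N), ρ < ‖x‖ → 0 ≤ V x)
    (hVinf : ∀ M : ℝ, ∃ R : ℝ, ∀ x : EuclideanSpace ℝ (Fin N), R < ‖x‖ → M < ‖x‖ ^ 2 * V x) :
    ¬ ∃ u : EuclideanSpace ℝ (Fin N) → ℝ,
        ContDiffOn ℝ 2 u {x | ρ < ‖x‖} ∧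
        (∀ x : EuclideanSpace ℝ (Fin N), ρ < ‖x‖ → 0 < u x) ∧
        (∀ x : EuclideanSpace ℝ (Fin N), ρ < ‖x‖ → -lap u x ≥ V x * u x) := by
  rintro ⟨u, hu, hpos, hsuper⟩
  obtain ⟨R₀, hR₀⟩ := hVinf ((768 + 48 * (N : ℝ)) ^ 2)
  obtain ⟨R, hRρ, hRR₀⟩ : ∃ R, ρ < R ∧ R₀ < R :=
    ⟨max ρ R₀ + 1, by linarith [le_max_left ρ R₀], by linarith [le_max_right ρ R₀]⟩
  have hR : 0 < R := hρ.trans hRρ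
  have hopen : IsOpen {x : EuclideanSpace ℝ (Fin N) | ρ < ‖x‖} :=
    isOpen_lt continuous_const continuous_norm
  let K : Set (EuclideanSpace ℝ (Fin N)) := {x | R ^ 2 ≤ ‖x‖ ^ 2 ∧ ‖x‖ ^ 2 ≤ 4 * R ^ 2}
  have hKR : ∀ x ∈ K, R ≤ ‖x‖ := fun x hx => le_of_sq_le_sq hx.1 (norm_nonneg x)
  have hKρ : ∀ x ∈ K, ρ < ‖x‖ := fun x hx => hRρ.trans_le (hKR x hx)
  have hcont : Continuous fun x : EuclideanSpace ℝ (Fin N) => ‖x‖ ^ 2 := continuous_norm.pow 2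
  have hKcompact : IsCompact K := by
    refine (isCompact_closedBall (0 : EuclideanSpace ℝ (Fin N)) (2 * R)).of_isClosed_subset
      ((isClosed_le continuous_const hcont).inter (isClosed_le hcont continuous_const)) ?_
    intro x hx
    rw [mem_closedBall_zero_iff]
    exact le_of_sq_le_sq (by nlinarith [hx.2]) (by positivity)
  let z : EuclideanSpace ℝ (Fin N) := EuclideanSpace.single ⟨0, by omega⟩ (3 / 2 * R)
  have hz : ‖z‖ ^ 2 = 9 / 4 * R ^ 2 := by
    simp only [z, PiLp.norm_single, Real.norm_eq_abs, sq_abs]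
    ring
  have hzK : z ∈ K := by
    constructor <;> rw [hz] <;> nlinarith
  obtain ⟨x, hxK, hxmax⟩ := hKcompact.exists_isMaxOn ⟨z, hzK⟩
    (f := fun y => annulusBump (R ^ 2) y / u y)
    ((contDiff_annulusBump _).continuous.continuousOn.div
      (hu.continuousOn.mono hKρ) fun y hy => (hpos y (hKρ y hy)).ne')
  have hux := hpos x (hKρ x hxK)
  set m := annulusBump (R ^ 2) x / u x with hm
  have hm_pos : 0 < m := by
    refine lt_of_lt_of_le (div_pos ?_ (hpos z (hKρ z hzK))) (hxmax hzK)
    rw [annulusBump, hz]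
    have : (9 / 4 * R ^ 2 - R ^ 2) * (4 * R ^ 2 - 9 / 4 * R ^ 2) = 35 / 16 * R ^ 4 := by ring
    rw [this]
    positivity
  have hmu : m * u x = annulusBump (R ^ 2) x := by
    rw [hm, div_mul_cancel₀ _ hux.ne']
  have hbump : 0 < annulusBump (R ^ 2) x := hmu ▸ mul_pos hm_pos hux
  have hlt₁ : R ^ 2 < ‖x‖ ^ 2 := by
    refine lt_of_le_of_ne hxK.1 fun h => hbump.ne' ?_
    simp [annulusBump, ← h]
  have hlt₂ : ‖x‖ ^ 2 < 4 * R ^ 2 := by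
    refine lt_of_le_of_ne hxK.2 fun h => hbump.ne' ?_
    simp [annulusBump, h]
  have hKnhds : ∀ᶠ y in 𝓝 x, y ∈ K := by
    filter_upwards [hcont.continuousAt.eventually_const_lt hlt₁,
      hcont.continuousAt.eventually_lt_const hlt₂] with y h₁ h₂ using ⟨h₁.le, h₂.le⟩
  have hmin : IsLocalMin (fun y => m * u y - annulusBump (R ^ 2) y) x := by
    filter_upwards [hKnhds] with y hy
    have h : annulusBump (R ^ 2) y / u y ≤ m := hxmax hy
    rw [div_le_iff₀ (hpos y (hKρ y hy))] at h
    linarith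
  have hux₂ : ContDiffAt ℝ 2 u x := hu.contDiffAt (hopen.mem_nhds (hKρ x hxK))
  have hwx₂ := (contDiff_annulusBump (N := N) (R ^ 2)).contDiffAt (x := x)
  have hlap := lap_nonneg_of_isLocalMin ((contDiffAt_const.mul hux₂).sub hwx₂) hmin
  rw [lap_const_mul_sub hux₂ hwx₂] at hlap
  have hsup : m * lap u x ≤ -(V x * annulusBump (R ^ 2) x) := by
    rw [← hmu]
    nlinarith [mul_le_mul_of_nonneg_left (hsuper x (hKρ x hxK)) hm_pos.le]
  have hsub := neg_norm_sq_mul_lap_annulusBump_le (pow_pos hR 2) hxK.1 hxK.2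
  have hV := mul_lt_mul_of_pos_right (hR₀ x (hRR₀.trans_le (hKR x hxK))) hbump
  have hscaled : ‖x‖ ^ 2 * lap (annulusBump (R ^ 2)) x ≤
      ‖x‖ ^ 2 * -(V x * annulusBump (R ^ 2) x) :=
    mul_le_mul_of_nonneg_left (by linarith) (by positivity)
  linarith
end
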